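/- arXiv:2010.13217 — 3 statements merged into one kernel-verified Lean document; each statement's English description precedes it below -/
import Mathlib

section
/- Fix q ∈ ℂ with 0 < ‖q‖ < 1. For nonzero z ∈ ℂ one has ϑ(z) = 0 if and only if z = q^k for some k ∈ ℤ. -/
/-- The q-Pochhammer function `φ(x) = ∏_{n≥0} (1 - qⁿ x)` (formula (3.10) of the paper). -/
noncomputable def phi (q x : ℂ) : ℂ := ∏' n : ℕ, (1 - q ^ n * x)

/-- The theta function `ϑ(z) = φ(qz) φ(z⁻¹)` (formula (3.13) of the paper). -/
noncomputable def theta (q z : ℂ) : ℂ := phi q (q * z) * phi q z⁻¹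

/-- The zeros of the `q`-Pochhammer function are the points `x` with `qⁿ x = 1` for some `n`. -/
theorem phi_eq_zero_iff {q : ℂ} (hq1 : ‖q‖ < 1) {x : ℂ} :
    phi q x = 0 ↔ ∃ n : ℕ, q ^ n * x = 1 := by
  constructor
  · contrapose!
    intro h
    simp only [phi, sub_eq_add_neg]
    refine tprod_one_add_ne_zero_of_summable (f := fun n : ℕ ↦ -(q ^ n * x)) (fun n ↦ ?_) ?_
    · rw [← sub_eq_add_neg]
      exact sub_ne_zero.mpr (h n).symm
    · simpa [norm_mul, norm_pow] using
        (summable_geometric_of_lt_one (norm_nonneg q) hq1).mul_right ‖x‖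
  · rintro ⟨n, h⟩
    exact tprod_of_exists_eq_zero ⟨n, by rw [h, sub_self]⟩

/-- **Zeros of ϑ** (Section 3.2.8 of the paper): for nonzero `z`, `ϑ(z) = 0` iff
`z ∈ q^ℤ`. -/
theorem theta_eq_zero_iff (q : ℂ) (hq0 : 0 < ‖q‖) (hq1 : ‖q‖ < 1)
    (z : ℂ) (hz : z ≠ 0) :
    theta q z = 0 ↔ ∃ k : ℤ, z = q ^ k := by
  have hq : q ≠ 0 := norm_pos_iff.mp hq0
  rw [theta, mul_eq_zero, phi_eq_zero_iff hq1, phi_eq_zero_iff hq1]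
  constructor
  · rintro (⟨n, h⟩ | ⟨n, h⟩)
    · refine ⟨-(n + 1 : ℤ), ?_⟩
      rw [zpow_neg, ← Nat.cast_succ, zpow_natCast]
      refine eq_inv_of_mul_eq_one_right ?_
      rw [pow_succ, mul_assoc, h]
    · refine ⟨n, ?_⟩
      rw [zpow_natCast]
      exact ((mul_inv_eq_one₀ hz).mp h).symm
  · rintro ⟨k, rfl⟩
    obtain ⟨n, rfl | rfl⟩ := k.eq_nat_or_neg
    · exact Or.inr ⟨n, by rw [zpow_natCast, mul_inv_cancel₀ (pow_ne_zero n hq)]⟩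
    · cases n with
      | zero => exact Or.inr ⟨0, by simp⟩
      | succ m =>
        refine Or.inl ⟨m, ?_⟩
        rw [zpow_neg, zpow_natCast, ← mul_assoc, ← pow_succ,
          mul_inv_cancel₀ (pow_ne_zero _ hq)]
end

section
/- Fix q ∈ ℂ with 0 < ‖q‖ < 1, let n ≥ 1, let a_1, …, a_n ∈ ℂ be nonzero, let z ∈ ℂ be nonzero, and let c_1, …, c_n ∈ ℂ. Define F(x) = Σ_{i=1}^{n} c_i · (ϑ(z x / a_i)/ϑ(z)) · ∏_{j≠i} ϑ(x/a_j)/ϑ(a_i/a_j) for x ∈ ℂ, x ≠ 0. Then for every nonzero x, F(q x) = (−1)^n q^{−n} z^{−1} x^{−n} (∏_{j=1}^{n} a_j) · F(x). -/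
theorem phi_eq_mul_phi {q : ℂ} (hq : ‖q‖ < 1) (x : ℂ) : phi q x = (1 - x) * phi q (q * x) := by
  have hm : Multipliable fun n : ℕ => 1 - q ^ (n + 1) * x := by
    have hs : Summable fun n : ℕ => ‖-(q ^ (n + 1) * x)‖ := by
      have h := ((summable_nat_add_iff 1).2
        (summable_geometric_of_lt_one (norm_nonneg q) hq)).mul_right ‖x‖
      simpa using h
    simpa only [sub_eq_add_neg] using multipliable_one_add_of_summable hs
  have h := tprod_eq_zero_mul' (f := fun n : ℕ => 1 - q ^ n * x) hm
  simpa only [phi, pow_zero, one_mul, pow_succ, mul_assoc] using h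

theorem theta_mul_left {q : ℂ} (hq0 : q ≠ 0) (hq : ‖q‖ < 1) {z : ℂ} (hz : z ≠ 0) :
    theta q (q * z) = -(q * z)⁻¹ * theta q z := by
  have hinv : q * (q * z)⁻¹ = z⁻¹ := by field_simp
  rw [theta, theta, phi_eq_mul_phi hq (q * z)⁻¹, phi_eq_mul_phi hq (q * z), hinv]
  field_simp
  ring

/-- **Quasi-periodicity of the elliptic interpolation sum** (formula (1.4) of the paper):
for `F(x) = Σᵢ cᵢ (ϑ(zx/aᵢ)/ϑ(z)) ∏_{j≠i} ϑ(x/aⱼ)/ϑ(aᵢ/aⱼ)` one has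
`F(qx) = (-1)ⁿ q^{-n} z⁻¹ x^{-n} (∏ⱼ aⱼ) F(x)`, expressing that `F` is a section of a
degree-`n` line bundle on `E = ℂ^×/q^ℤ`. -/
theorem elliptic_interpolation_quasi_periodicity
    (q : ℂ) (hq0 : 0 < ‖q‖) (hq1 : ‖q‖ < 1)
    (n : ℕ) (hn : 1 ≤ n) (a : ℕ → ℂ)
    (ha0 : ∀ i < n, a i ≠ 0)
    (z : ℂ) (hz : z ≠ 0)
    (c : ℕ → ℂ) (F : ℂ → ℂ)
    (hF : ∀ x : ℂ, x ≠ 0 → F x = ∑ i ∈ Finset.range n,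
        c i * (theta q (z * x / a i) / theta q z) *
          ∏ j ∈ (Finset.range n).erase i, theta q (x / a j) / theta q (a i / a j)) :
    ∀ x : ℂ, x ≠ 0 →
      F (q * x) = (-1 : ℂ) ^ n * q ^ (-(n : ℤ)) * z⁻¹ * x ^ (-(n : ℤ)) *
        (∏ j ∈ Finset.range n, a j) * F x := by
  intro x hx
  have hq : q ≠ 0 := norm_pos_iff.1 hq0
  rw [hF _ (mul_ne_zero hq hx), hF x hx, Finset.mul_sum]
  refine Finset.sum_congr rfl fun i hi => ?_
  have hai : a i ≠ 0 := ha0 i (Finset.mem_range.1 hi)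
  have hfactor : ∀ j ∈ (Finset.range n).erase i,
      theta q (q * x / a j) / theta q (a i / a j) =
        -(q * x)⁻¹ * a j * (theta q (x / a j) / theta q (a i / a j)) := by
    intro j hj
    have haj : a j ≠ 0 := ha0 j (Finset.mem_range.1 (Finset.mem_of_mem_erase hj))
    rw [mul_div_assoc, theta_mul_left hq hq1 (div_ne_zero hx haj), ← mul_div_assoc q, inv_div]
    ring
  have hprefactor : theta q (z * (q * x) / a i) =
      z⁻¹ * (-(q * x)⁻¹ * a i) * theta q (z * x / a i) := by
    rw [show z * (q * x) / a i = q * (z * x / a i) by ring,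
      theta_mul_left hq hq1 (div_ne_zero (mul_ne_zero hz hx) hai)]
    field_simp
  have hmultiplier : (-1 : ℂ) ^ n * q ^ (-(n : ℤ)) * z⁻¹ * x ^ (-(n : ℤ)) *
      (∏ j ∈ Finset.range n, a j) = z⁻¹ * ∏ j ∈ Finset.range n, -(q * x)⁻¹ * a j := by
    rw [Finset.prod_mul_distrib, Finset.prod_const, Finset.card_range, zpow_neg, zpow_neg,
      zpow_natCast, zpow_natCast, neg_pow (q * x)⁻¹, inv_pow, mul_pow, mul_inv]
    ring
  rw [Finset.prod_congr rfl hfactor, Finset.prod_mul_distrib, hprefactor, hmultiplier,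
    ← Finset.mul_prod_erase _ _ hi]
  ring
end

section
/- With the notation for f_m below, let 1 ≤ k ≤ n, let μ_1 < μ_2 < … < μ_k be a strictly increasing sequence in {1, …, n}, let s, t ∈ {1, …, k} with s ≠ t, let l ∈ {1, …, n}, and let w, w′ ∈ ℂ \ {0}. If f_{μ_s}(a_l, w) · f_{μ_t}(h^{−2} a_l, w′) ≠ 0, then μ_s ≤ l ≤ μ_t and s < t. -/
/-- The constant `c_m = (-1)ⁿ h^{2m-n}` of formula (A.6) of the paper
(here `h` is a square root of `ħ`, so `ħ = h²`). -/
noncomputable def cc (n : ℕ) (h : ℂ) (m : ℕ) : ℂ :=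
  (-1 : ℂ) ^ n * h ^ (2 * (m : ℤ) - (n : ℤ))

/-- The building block `f_m(x, w)` of the elliptic stable envelope for `T*Gr(k,n)`
(formula (A.6) of the paper):
`f_m(x,w) = (ϑ(c_m x w⁻¹ a_m⁻¹)/ϑ(c_m w⁻¹)) ∏_{i<m} ϑ(x/aᵢ) ∏_{i>m} ϑ(h²x/aᵢ)`. -/
noncomputable def fEnv (q h : ℂ) (n : ℕ) (a : ℕ → ℂ) (m : ℕ) (x w : ℂ) : ℂ :=
  (theta q (cc n h m * x * w⁻¹ * (a m)⁻¹) / theta q (cc n h m * w⁻¹)) *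
    (∏ i ∈ Finset.Ico 1 m, theta q (x / a i)) *
    (∏ i ∈ Finset.Ioc m n, theta q (h ^ 2 * x / a i))

theorem phi_one (q : ℂ) : phi q 1 = 0 :=
  tprod_of_exists_eq_zero ⟨0, by simp⟩

theorem theta_one (q : ℂ) : theta q 1 = 0 := by
  simp [theta, phi_one]

/-- `f_m(·, w)` vanishes at `a_l` for `l < m`. -/
theorem fEnv_apply_eq_zero_of_lt {q h : ℂ} {n : ℕ} {a : ℕ → ℂ} {m l : ℕ} (w : ℂ)
    (hl : 1 ≤ l) (hlm : l < m) (ha : a l ≠ 0) : fEnv q h n a m (a l) w = 0 := by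
  have hprod : ∏ i ∈ Finset.Ico 1 m, theta q (a l / a i) = 0 :=
    Finset.prod_eq_zero (Finset.mem_Ico.2 ⟨hl, hlm⟩) (by rw [div_self ha, theta_one])
  rw [fEnv, hprod, mul_zero, zero_mul]

/-- `f_m(·, w)` vanishes at `h⁻² a_l` for `m < l`. -/
theorem fEnv_zpow_mul_eq_zero_of_lt {q h : ℂ} {n : ℕ} {a : ℕ → ℂ} {m l : ℕ} (w : ℂ)
    (hh : h ≠ 0) (hml : m < l) (hln : l ≤ n) (ha : a l ≠ 0) :
    fEnv q h n a m (h ^ (-2 : ℤ) * a l) w = 0 := by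
  have harg : h ^ 2 * (h ^ (-2 : ℤ) * a l) / a l = 1 := by
    rw [zpow_neg]
    norm_cast
    field_simp
  have hprod : ∏ i ∈ Finset.Ioc m n, theta q (h ^ 2 * (h ^ (-2 : ℤ) * a l) / a i) = 0 :=
    Finset.prod_eq_zero (Finset.mem_Ioc.2 ⟨hml, hln⟩) (by rw [harg, theta_one])
  rw [fEnv, hprod, mul_zero]

/-- **Key step in the proof of the wheel condition** (Lemma A.2 of the paper): if the
`f`-factors of a term of the elliptic stable envelope are both nonzero at the wheel
locus `x = (a_l, ħ⁻¹ a_l, …)`, then `μ_s ≤ l ≤ μ_t`, which forces `s < t` by strict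
monotonicity of `μ`. -/
theorem fEnv_wheel_condition_step
    (q : ℂ) (hq0 : 0 < ‖q‖) (hq1 : ‖q‖ < 1)
    (h : ℂ) (hh : h ≠ 0)
    (n : ℕ) (hn : 1 ≤ n) (a : ℕ → ℂ)
    (ha0 : ∀ i ∈ Finset.Icc 1 n, a i ≠ 0)
    (hdist : ∀ i ∈ Finset.Icc 1 n, ∀ j ∈ Finset.Icc 1 n, i ≠ j → a i ≠ a j)
    (k : ℕ) (hk1 : 1 ≤ k) (hkn : k ≤ n)
    (μ : ℕ → ℕ)
    (hμmem : ∀ r ∈ Finset.Icc 1 k, μ r ∈ Finset.Icc 1 n)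
    (hμmono : ∀ r ∈ Finset.Icc 1 k, ∀ r' ∈ Finset.Icc 1 k, r < r' → μ r < μ r')
    (s t : ℕ) (hs : s ∈ Finset.Icc 1 k) (ht : t ∈ Finset.Icc 1 k) (hst : s ≠ t)
    (l : ℕ) (hl : l ∈ Finset.Icc 1 n)
    (w w' : ℂ) (hw : w ≠ 0) (hw' : w' ≠ 0)
    (hne : fEnv q h n a (μ s) (a l) w *
        fEnv q h n a (μ t) (h ^ (-2 : ℤ) * a l) w' ≠ 0) :
    μ s ≤ l ∧ l ≤ μ t ∧ s < t := by
  obtain ⟨hl1, hln⟩ := Finset.mem_Icc.1 hl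
  have hsl : μ s ≤ l := by
    by_contra! hlt
    exact left_ne_zero_of_mul hne (fEnv_apply_eq_zero_of_lt w hl1 hlt (ha0 l hl))
  have hlt : l ≤ μ t := by
    by_contra! hlt
    exact right_ne_zero_of_mul hne (fEnv_zpow_mul_eq_zero_of_lt w' hh hlt hln (ha0 l hl))
  refine ⟨hsl, hlt, hst.lt_or_gt.resolve_right fun hts => ?_⟩
  exact (hμmono t ht s hs hts).not_ge (hsl.trans hlt)
end
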